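/- arXiv:2002.06265 — 2 statements merged into one kernel-verified Lean document; each statement's English description precedes it below -/
import Mathlib

section
/- Let S be a string, let q ≥ 2 be a natural number, and let i, j be indices of characters in S$. Then there are at most 18·q·(1 + log_q|S|) different maximal pairs (n_k, m_k, l_k) of S such that for all k: (a) if |S[n_k..i−1]| ≥ |S[i..n_k+l_k−1]| then S[n_k..i−1] is not a fractional power with exponent ≥ q, and if |S[n_k..i−1]| < |S[i..n_k+l_k−1]| then S[i..n_k+l_k−1] is not a fractional power with exponent ≥ q; (b) i ∈ [n_k, n_k+l_k]; and (c) j ∈ [m_k, m_k+l_k]. -/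
variable {α : Type*}

/-- Character at 1-based position `i` of `S`; the sentinel `dollar` outside `[1, |S|]`,
in particular `S[0] = $` and `S[|S|+1] = $`. -/
def chr (dollar : α) (S : List α) (i : ℕ) : α :=
  if h : 1 ≤ i ∧ i ≤ S.length then S.get ⟨i - 1, by omega⟩ else dollar

/-- The substring `S[i..j]` (as a list), using the sentinel convention. -/
def substr (dollar : α) (S : List α) (i j : ℕ) : List α :=
  (List.range (j + 1 - i)).map (fun k => chr dollar S (i + k))

/-- `Δ` is a period of `T`: `Δ ≥ 1` and characters at distance `Δ` coincide. -/
def IsPeriodOf (Δ : ℕ) (T : List α) : Prop :=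
  1 ≤ Δ ∧ ∀ (k : ℕ) (h : k + Δ < T.length), T.get ⟨k, by omega⟩ = T.get ⟨k + Δ, h⟩

/-- The minimal period length of `T`. -/
noncomputable def minPeriod (T : List α) : ℕ := sInf {Δ | IsPeriodOf Δ T}

/-- `T` is a fractional power with exponent ≥ `q`: its minimal period `Δ` satisfies `|T| ≥ q·Δ`. -/
def IsFracPowGe (q : ℕ) (T : List α) : Prop := q * minPeriod T ≤ T.length

/-- `(n, m, l)` is a maximal pair of `S` (`l ≥ 1`, both occurrences inside `S`,
equal as strings, different preceding characters, different succeeding characters). -/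
def IsMaximalPair (dollar : α) (S : List α) (n m l : ℕ) : Prop :=
  1 ≤ l ∧ 1 ≤ n ∧ 1 ≤ m ∧ n + l - 1 ≤ S.length ∧ m + l - 1 ≤ S.length ∧
  (∀ k < l, chr dollar S (n + k) = chr dollar S (m + k)) ∧
  chr dollar S (n - 1) ≠ chr dollar S (m - 1) ∧
  chr dollar S (n + l) ≠ chr dollar S (m + l)

/-- The two maximal pairs `p`, `p'` of `S` are copies of each other: the unordered pairs of
padded occurrence strings `{S[n-1..n+l], S[m-1..m+l]}` coincide. -/
def CopiesMP (dollar : α) (S : List α) (p p' : ℕ × ℕ × ℕ) : Prop :=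
  ({substr dollar S (p.1 - 1) (p.1 + p.2.2), substr dollar S (p.2.1 - 1) (p.2.1 + p.2.2)} :
      Set (List α)) =
  ({substr dollar S (p'.1 - 1) (p'.1 + p'.2.2), substr dollar S (p'.2.1 - 1) (p'.2.1 + p'.2.2)} :
      Set (List α))

/-- `P` occurs at least twice in `T` (occurrences may overlap). -/
def OccursTwiceIn (P T : List α) : Prop :=
  ∃ p₁ p₂ : ℕ, p₁ < p₂ ∧ p₂ + P.length ≤ T.length ∧ P <+: T.drop p₁ ∧ P <+: T.drop p₂

/-- `L` is the (self-referential) LZ77-decomposition of `S`: each factor is either a fresh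
single character, or the longest prefix of the remaining suffix occurring at least twice in
the text up to (and including) this factor. -/
def IsLZ77 (S : List α) (L : List (List α)) : Prop :=
  S = L.flatten ∧
  ∀ (i : ℕ) (h : i < L.length),
    L.get ⟨i, h⟩ ≠ [] ∧
    ((∃ c : α, L.get ⟨i, h⟩ = [c] ∧ c ∉ (L.take i).flatten) ∨
     (OccursTwiceIn (L.get ⟨i, h⟩) ((L.take i).flatten ++ L.get ⟨i, h⟩) ∧
      ∀ F' : List α, F' <+: S.drop ((L.take i).flatten).length →
        OccursTwiceIn F' ((L.take i).flatten ++ F') → F'.length ≤ (L.get ⟨i, h⟩).length))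

/-- The cyclic rotation of `S$` by `k`. -/
def rot (dollar : α) (S : List α) (k : ℕ) : List α :=
  (S ++ [dollar]).drop k ++ (S ++ [dollar]).take k

/-- `π` enumerates (1-based, for `i = 1, …, |S|+1`) the cyclic rotations of `S$`
in lexicographic order; the BWT of `S` is then `i ↦ S[π i]`. -/
def IsBWTPerm [LinearOrder α] (dollar : α) (S : List α) (π : ℕ → ℕ) : Prop :=
  (∀ i, 1 ≤ i → i ≤ S.length + 1 → π i ≤ S.length) ∧
  (∀ i j, 1 ≤ i → i < j → j ≤ S.length + 1 →
    List.Lex (· < ·) (rot dollar S (π i)) (rot dollar S (π j)))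

/-- Number of occurrences of `P` in `T`. -/
def occCount [DecidableEq α] (P T : List α) : ℕ :=
  ((Finset.range (T.length + 1)).filter
    (fun p => p + P.length ≤ T.length ∧ P <+: T.drop p)).card

/-- `P` is a maximal repeat of `S`: nonempty, occurs at least twice, and every one-character
extension occurs strictly fewer times. -/
def IsMaximalRepeat [DecidableEq α] (S P : List α) : Prop :=
  P ≠ [] ∧ 2 ≤ occCount P S ∧
  (∀ c : α, occCount (c :: P) S < occCount P S) ∧
  (∀ c : α, occCount (P ++ [c]) S < occCount P S)

/-- `u` is primitive: not expressible as `v^k` with `k ≥ 2`. -/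
def Primitive (u : List α) : Prop :=
  ∀ (v : List α) (k : ℕ), 2 ≤ k → u ≠ (List.replicate k v).flatten

/-- `(l', r')` is the maximal `Δ`-periodic extension of the occurrence `S[l..r]`
(the padded maximal `Δ`-periodic extension is then `(l'-1, r'+1)`). -/
def IsMaxPerExt (dollar : α) (S : List α) (Δ l r l' r' : ℕ) : Prop :=
  1 ≤ l' ∧ l' ≤ l ∧ l ≤ r ∧ r ≤ r' ∧ r' ≤ S.length ∧ Δ ≤ r + 1 - l ∧
  IsPeriodOf Δ (substr dollar S l' r') ∧
  ¬ IsPeriodOf Δ (substr dollar S (l' - 1) r') ∧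
  ¬ IsPeriodOf Δ (substr dollar S l' (r' + 1))

/-- The maximal periodic extension (w.r.t. the minimal period length) of the occurrence
`S[l..r]` adds at most one period length of additional characters. -/
def ShortExt (dollar : α) (S : List α) (l r : ℕ) : Prop :=
  ∃ l' r', IsMaxPerExt dollar S (minPeriod (substr dollar S l r)) l r l' r' ∧
    (l - l') + (r' - r) ≤ minPeriod (substr dollar S l r)

/-- The first `L` characters of the infinite word `X` have period `r`. -/
def PrefixPeriod (X : ℕ → α) (r L : ℕ) : Prop :=
  ∀ t, t + r < L → X t = X (t + r)

theorem PrefixPeriod.mono {X : ℕ → α} {r L L' : ℕ} (h : PrefixPeriod X r L) (hL : L' ≤ L) :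
    PrefixPeriod X r L' :=
  fun t ht => h t (lt_of_lt_of_le ht hL)

/-- A period `p` of a prefix of length `c` is inherited by every longer prefix having a period
`e ≥ 1` with `p + e ≤ c`. -/
theorem PrefixPeriod.extend {X : ℕ → α} {p e c a : ℕ} (hp : PrefixPeriod X p c)
    (he : PrefixPeriod X e a) (he1 : 1 ≤ e) (hc : p + e ≤ c) :
    PrefixPeriod X p a := by
  intro t
  induction t using Nat.strong_induction_on with
  | _ t ih =>
    intro ht
    by_cases h : t + p < c
    · exact hp t h
    · have h1 := he (t - e) (by omega)
      have h2 := he (t - e + p) (by omega)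
      have h3 := ih (t - e) (by omega) (by omega)
      rw [show t - e + e = t by omega] at h1
      rw [show t - e + p + e = t + p by omega] at h2
      rw [← h1, ← h2, h3]

/-- A family of integers with pairwise gaps at least `g` in an interval of radius `w`. -/
theorem card_le_of_gaps {ι : Type*} (M : Finset ι) (y : ι → ℤ) (z : ℤ) (w g N : ℕ)
    (hw : ∀ s ∈ M, |y s - z| ≤ w) (hgap : ∀ s ∈ M, ∀ s' ∈ M, s ≠ s' → (g : ℤ) ≤ |y s - y s'|)
    (hN : 2 * w < N * g) : M.card ≤ N := by
  have hg : (0 : ℤ) < g := by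
    rcases Nat.eq_zero_or_pos g with rfl | h
    · simp at hN
    · exact_mod_cast h
  have hN' : (2 * w : ℤ) < N * g := by exact_mod_cast hN
  have hcard : (Finset.Ico (0 : ℤ) N).card = N := by simp
  rw [← hcard]
  refine Finset.card_le_card_of_injOn (fun s => (y s - (z - w)) / g) ?_ ?_
  · intro s hs
    have h := abs_le.1 (hw s hs)
    simp only [Finset.coe_Ico, Set.mem_Ico]
    refine ⟨Int.ediv_nonneg (by linarith [h.1]) hg.le, ?_⟩
    exact Int.ediv_lt_of_lt_mul hg (by linarith [h.2])
  · intro s hs s' hs' heq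
    by_contra hne
    have h := hgap s hs s' hs' hne
    have h1 := Int.emod_add_mul_ediv (y s - (z - w)) g
    have h2 := Int.emod_add_mul_ediv (y s' - (z - w)) g
    simp only at heq
    rw [heq] at h1
    have h3 := Int.emod_nonneg (y s - (z - w)) hg.ne'
    have h4 := Int.emod_nonneg (y s' - (z - w)) hg.ne'
    have h5 := Int.emod_lt_of_pos (y s - (z - w)) hg
    have h6 := Int.emod_lt_of_pos (y s' - (z - w)) hg
    have h7 : |y s - y s'| < g := abs_lt.2 ⟨by linarith, by linarith⟩
    linarith

/-- Two occurrences of a prefix at distance `e` make `e` a period of that prefix. -/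
theorem prefixPeriod_of_occurrences (F : ℤ → α) (u y y' : ℤ) (L : ℕ)
    (h : ∀ t : ℕ, t < L → F (u + t) = F (y + t)) (h' : ∀ t : ℕ, t < L → F (u + t) = F (y' + t)) :
    PrefixPeriod (fun t : ℕ => F (u + t)) (y - y').natAbs L := by
  intro t ht
  simp only
  rcases le_total y y' with hy | hy
  · rw [h (t + (y - y').natAbs) ht, h' t (by omega)]
    congr 1
    omega
  · rw [h' (t + (y - y').natAbs) ht, h t (by omega)]
    congr 1
    omega

/-- Occurrences, close to `z`, of prefixes that have lengths in `[c, q c)` and are not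
fractional powers of exponent at least `q`. -/
theorem card_occurrences_scale_le {ι : Type*} (F : ℤ → α) (u z : ℤ) (q c : ℕ)
    (hc : 1 ≤ c) (M : Finset ι) (y : ι → ℤ) (a : ι → ℕ) (hinj : Set.InjOn y M)
    (hca : ∀ s ∈ M, c ≤ a s) (hac : ∀ s ∈ M, a s < q * c)
    (hagree : ∀ s ∈ M, ∀ t : ℕ, t < a s → F (u + t) = F (y s + t))
    (hz : ∀ s ∈ M, |y s - z| ≤ a s)
    (hpow : ∀ s ∈ M, ∀ r, 1 ≤ r → PrefixPeriod (fun t : ℕ => F (u + t)) r (a s) → a s < q * r) :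
    M.card ≤ 6 * q := by
  classical
  set X : ℕ → α := fun t => F (u + t) with hX
  have hex : ∃ r, 1 ≤ r ∧ PrefixPeriod X r c := ⟨c, hc, fun t ht => by omega⟩
  obtain ⟨p, ⟨hp1, hp⟩, hmin⟩ :
      ∃ p, (1 ≤ p ∧ PrefixPeriod X p c) ∧ ∀ r, 1 ≤ r → PrefixPeriod X r c → p ≤ r :=
    ⟨Nat.find hex, Nat.find_spec hex, fun r h1 h2 => Nat.find_min' hex ⟨h1, h2⟩⟩
  have hdist : ∀ s ∈ M, ∀ s' ∈ M, s ≠ s' → 1 ≤ (y s - y s').natAbs := by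
    intro s hs s' hs' hne
    have : y s ≠ y s' := fun h => hne (hinj hs hs' h)
    omega
  have hper : ∀ s ∈ M, ∀ s' ∈ M,
      PrefixPeriod X (y s - y s').natAbs (min (a s) (a s')) := fun s hs s' hs' =>
    prefixPeriod_of_occurrences F u (y s) (y s') _
      (fun t ht => hagree s hs t (by omega)) (fun t ht => hagree s' hs' t (by omega))
  have hgap : ∀ s ∈ M, ∀ s' ∈ M, s ≠ s' → p ≤ (y s - y s').natAbs := fun s hs s' hs' hne =>
    hmin _ (hdist s hs s' hs' hne)
      ((hper s hs s' hs').mono (le_min (hca s hs) (hca s' hs')))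
  rw [← Finset.card_filter_add_card_filter_not (fun s => PrefixPeriod X p (a s))]
  have h1 : (M.filter (fun s => PrefixPeriod X p (a s))).card ≤ 2 * q := by
    rcases Nat.eq_zero_or_pos q with rfl | hq
    · rw [Finset.filter_eq_empty_iff.2 fun s hs => by simpa using hac s hs]
      simp
    have hqp : 1 ≤ q * p := Nat.mul_pos hq hp1
    refine card_le_of_gaps _ y z (q * p - 1) p (2 * q) ?_ ?_ ?_
    · intro s hs
      rw [Finset.mem_filter] at hs
      have := hz s hs.1
      have := hpow s hs.1 p hp1 hs.2
      omega
    · intro s hs s' hs' hne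
      rw [Finset.mem_filter] at hs hs'
      have := hgap s hs.1 s' hs'.1 hne
      rw [Int.abs_eq_natAbs]
      omega
    · rw [Nat.mul_assoc]
      omega
  have h2 : (M.filter (fun s => ¬ PrefixPeriod X p (a s))).card ≤ 4 * q := by
    rcases Nat.eq_zero_or_pos q with rfl | hq
    · rw [Finset.filter_eq_empty_iff.2 fun s hs => by simpa using hac s hs]
      simp
    have hqc : 1 ≤ q * c := Nat.mul_pos hq hc
    refine card_le_of_gaps _ y z (q * c - 1) (c / 2 + 1) (4 * q) ?_ ?_ ?_
    · intro s hs
      rw [Finset.mem_filter] at hs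
      have := hz s hs.1
      have := hac s hs.1
      omega
    · intro s hs s' hs' hne
      rw [Finset.mem_filter] at hs hs'
      have hpe := hgap s hs.1 s' hs'.1 hne
      have he1 := hdist s hs.1 s' hs'.1 hne
      have he := hper s hs.1 s' hs'.1
      have hca1 := hca s hs.1
      have hca2 := hca s' hs'.1
      generalize hE : (y s - y s').natAbs = e at *
      have hlong : c < p + e := by
        by_contra hcon
        have hext := hp.extend he he1 (by omega)
        rcases le_total (a s) (a s') with h | h
        · exact hs.2 (by rwa [min_eq_left h] at hext)
        · exact hs'.2 (by rwa [min_eq_right h] at hext)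
      rw [Int.abs_eq_natAbs, hE]
      omega
    · have : q * c ≤ q * (2 * (c / 2 + 1)) := Nat.mul_le_mul_left q (by omega)
      have h4 : 4 * q * (c / 2 + 1) = 2 * (q * (2 * (c / 2 + 1))) := by ring
      omega
  omega

/-- As `card_occurrences_scale_le`, for all prefix lengths in `[1, n]`. -/
theorem card_occurrences_le {ι : Type*} (F : ℤ → α) (u z : ℤ) (q n : ℕ) (hq : 2 ≤ q)
    (M : Finset ι) (y : ι → ℤ) (a : ι → ℕ) (hinj : Set.InjOn y M)
    (ha : ∀ s ∈ M, 1 ≤ a s ∧ a s ≤ n)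
    (hagree : ∀ s ∈ M, ∀ t : ℕ, t < a s → F (u + t) = F (y s + t))
    (hz : ∀ s ∈ M, |y s - z| ≤ a s)
    (hpow : ∀ s ∈ M, ∀ r, 1 ≤ r → PrefixPeriod (fun t : ℕ => F (u + t)) r (a s) → a s < q * r) :
    M.card ≤ 6 * q * (Nat.log q n + 1) := by
  classical
  have hmaps : ∀ s ∈ M, Nat.log q (a s) ∈ Finset.range (Nat.log q n + 1) := fun s hs =>
    Finset.mem_range.2 (Nat.lt_succ_of_le (Nat.log_mono_right (ha s hs).2))
  refine (Finset.card_le_mul_card_image_of_maps_to hmaps (6 * q) ?_).trans_eq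
    (by rw [Finset.card_range])
  intro k _
  have hsub : M.filter (fun s => Nat.log q (a s) = k) ⊆ M := Finset.filter_subset _ _
  refine card_occurrences_scale_le F u z q (q ^ k) (Nat.pow_pos (by omega)) _ y a
    (hinj.mono (by exact_mod_cast hsub)) ?_ ?_ (fun s hs => hagree s (hsub hs))
    (fun s hs => hz s (hsub hs)) (fun s hs => hpow s (hsub hs))
  · intro s hs
    rw [Finset.mem_filter] at hs
    rw [← hs.2]
    exact Nat.pow_log_le_self q (by have := ha s hs.1; omega)
  · intro s hs
    rw [Finset.mem_filter] at hs
    rw [← hs.2, ← pow_succ']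
    exact Nat.lt_pow_succ_log_self (by omega) _

theorem length_substr (dollar : α) (S : List α) (i j : ℕ) :
    (substr dollar S i j).length = j + 1 - i := by
  simp [substr]

theorem isPeriodOf_substr {dollar : α} {S : List α} {i j r : ℕ} (hr : 1 ≤ r)
    (h : ∀ k, k + r < j + 1 - i → chr dollar S (i + k) = chr dollar S (i + (k + r))) :
    IsPeriodOf r (substr dollar S i j) := by
  refine ⟨hr, fun k hk => ?_⟩
  rw [length_substr] at hk
  simpa [substr] using h k hk

theorem length_lt_of_not_isFracPowGe {q r : ℕ} {T : List α} (hT : ¬ IsFracPowGe q T)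
    (hr : IsPeriodOf r T) : T.length < q * r :=
  (not_le.1 hT).trans_le (Nat.mul_le_mul_left q (Nat.sInf_le hr))

/-- A maximal pair whose first occurrence touches `i` is determined by its shift. -/
theorem IsMaximalPair.eq_of_shift_eq {dollar : α} {S : List α} {n m l n' m' l' i : ℕ}
    (h : IsMaximalPair dollar S n m l) (h' : IsMaximalPair dollar S n' m' l')
    (hi : n ≤ i ∧ i ≤ n + l) (hi' : n' ≤ i ∧ i ≤ n' + l') (hshift : m + n' = m' + n) :
    n = n' ∧ m = m' ∧ l = l' := by
  obtain ⟨_, hn, hm, _, _, heq, hleft, hright⟩ := h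
  obtain ⟨_, hn', hm', _, _, heq', hleft', hright'⟩ := h'
  have hnn : n = n' := by
    rcases lt_trichotomy n n' with hlt | rfl | hlt
    · refine absurd (heq (n' - 1 - n) (by omega)) ?_
      rwa [show n + (n' - 1 - n) = n' - 1 by omega, show m + (n' - 1 - n) = m' - 1 by omega]
    · rfl
    · refine absurd (heq' (n - 1 - n') (by omega)) ?_
      rwa [show n' + (n - 1 - n') = n - 1 by omega, show m' + (n - 1 - n') = m - 1 by omega]
  subst hnn
  obtain rfl : m = m' := by omega
  refine ⟨rfl, rfl, ?_⟩
  rcases lt_trichotomy l l' with hlt | rfl | hlt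
  · exact absurd (heq' l hlt) hright
  · rfl
  · exact absurd (heq l' hlt) hright'


/-- Lemma `nonhighly`. For indices `i`, `j` of characters in `S$` there are
at most `18·q·(1 + log_q|S|)` maximal pairs crossing `i` resp. `j` such that the longer of the
two parts of the first occurrence split at `i` is not a fractional power with exponent `≥ q`. -/
theorem maximal_pairs_longer_part_not_power (dollar : α) (S : List α)
    (hdollar : dollar ∉ S)
    (q : ℕ) (hq : 2 ≤ q)
    (i j : ℕ) (hi : 1 ≤ i ∧ i ≤ S.length + 1) (hj : 1 ≤ j ∧ j ≤ S.length + 1)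
    (M : Finset (ℕ × ℕ × ℕ))
    (hM : ∀ p ∈ M, IsMaximalPair dollar S p.1 p.2.1 p.2.2 ∧
      ((substr dollar S p.1 (i - 1)).length ≥ (substr dollar S i (p.1 + p.2.2 - 1)).length →
        ¬ IsFracPowGe q (substr dollar S p.1 (i - 1))) ∧
      ((substr dollar S p.1 (i - 1)).length < (substr dollar S i (p.1 + p.2.2 - 1)).length →
        ¬ IsFracPowGe q (substr dollar S i (p.1 + p.2.2 - 1))) ∧
      (p.1 ≤ i ∧ i ≤ p.1 + p.2.2) ∧
      (p.2.1 ≤ j ∧ j ≤ p.2.1 + p.2.2)) :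
    (M.card : ℝ) ≤ 18 * (q : ℝ) * (1 + Real.logb (q : ℝ) (S.length : ℝ)) := by
  classical
  have hinj : ∀ p ∈ M, ∀ p' ∈ M, p.2.1 + p'.1 = p'.2.1 + p.1 → p = p' := by
    intro p hp p' hp' h
    obtain ⟨h1, -, -, h2, -⟩ := hM p hp
    obtain ⟨h1', -, -, h2', -⟩ := hM p' hp'
    obtain ⟨e1, e2, e3⟩ := h1.eq_of_shift_eq h1' h2 h2' h
    exact Prod.ext e1 (Prod.ext e2 e3)
  have hleft : (M.filter (fun p => p.1 + p.2.2 - i ≤ i - p.1)).card ≤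
      6 * q * (Nat.log q S.length + 1) := by
    refine card_occurrences_le (fun x : ℤ => chr dollar S (-x).toNat) (-(i - 1)) (-(j - 1)) q _ hq
      _ (fun p => -((p.2.1 : ℤ) + i - p.1 - 1)) (fun p => i - p.1) ?_ ?_ ?_ ?_ ?_
    · intro p hp p' hp' h
      simp only [Finset.coe_filter, Set.mem_ofPred_eq] at hp hp' h
      exact hinj p hp.1 p' hp'.1 (by omega)
    · intro p hp
      rw [Finset.mem_filter] at hp
      obtain ⟨⟨hl, hn, -, hnl, -⟩, -, -, h2, -⟩ := hM p hp.1
      omega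
    · intro p hp t ht
      rw [Finset.mem_filter] at hp
      obtain ⟨⟨hl, hn, hm, -, -, heq, -⟩, -, -, h2, -⟩ := hM p hp.1
      convert heq (i - p.1 - 1 - t) (by omega) using 2 <;> omega
    · intro p hp
      rw [Finset.mem_filter] at hp
      obtain ⟨-, -, -, h2, h3⟩ := hM p hp.1
      rw [abs_le]
      omega
    · intro p hp r hr hper
      rw [Finset.mem_filter] at hp
      obtain ⟨-, hl, -, h2, -⟩ := hM p hp.1
      rw [length_substr, length_substr] at hl
      have hP : IsPeriodOf r (substr dollar S p.1 (i - 1)) := by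
        refine isPeriodOf_substr hr fun k hk => ?_
        have h := hper (i - 1 - (p.1 + k + r)) (by omega)
        simp only at h
        convert h.symm using 2 <;> omega
      have := length_lt_of_not_isFracPowGe (hl (by omega)) hP
      rw [length_substr] at this
      omega
  have hright : (M.filter (fun p => ¬ p.1 + p.2.2 - i ≤ i - p.1)).card ≤
      6 * q * (Nat.log q S.length + 1) := by
    refine card_occurrences_le (fun x : ℤ => chr dollar S x.toNat) i j q _ hq
      _ (fun p => (p.2.1 : ℤ) + i - p.1) (fun p => p.1 + p.2.2 - i) ?_ ?_ ?_ ?_ ?_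
    · intro p hp p' hp' h
      simp only [Finset.coe_filter, Set.mem_ofPred_eq] at hp hp' h
      exact hinj p hp.1 p' hp'.1 (by omega)
    · intro p hp
      rw [Finset.mem_filter] at hp
      obtain ⟨⟨hl, hn, -, hnl, -⟩, -, -, h2, -⟩ := hM p hp.1
      omega
    · intro p hp t ht
      rw [Finset.mem_filter] at hp
      obtain ⟨⟨hl, hn, hm, -, -, heq, -⟩, -, -, h2, -⟩ := hM p hp.1
      convert heq (i - p.1 + t) (by omega) using 2 <;> omega
    · intro p hp
      rw [Finset.mem_filter] at hp
      obtain ⟨-, -, -, h2, h3⟩ := hM p hp.1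
      rw [abs_le]
      omega
    · intro p hp r hr hper
      rw [Finset.mem_filter] at hp
      obtain ⟨⟨hl1, -⟩, -, hl, h2, -⟩ := hM p hp.1
      rw [length_substr, length_substr] at hl
      have hP : IsPeriodOf r (substr dollar S i (p.1 + p.2.2 - 1)) := by
        refine isPeriodOf_substr hr fun k hk => ?_
        have h := hper k (by omega)
        simp only at h
        convert h using 2 <;> omega
      have := length_lt_of_not_isFracPowGe (hl (by omega)) hP
      rw [length_substr] at this
      omega
  have hcard : M.card ≤ 12 * q * (Nat.log q S.length + 1) := by
    rw [← Finset.card_filter_add_card_filter_not (fun p => p.1 + p.2.2 - i ≤ i - p.1)]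
    linarith
  have hcard' : (M.card : ℝ) ≤ 12 * q * (Nat.log q S.length + 1) := by exact_mod_cast hcard
  have hlog : (Nat.log q S.length : ℝ) ≤ Real.logb q S.length := Real.natLog_le_logb _ _
  have h0 : (0 : ℝ) ≤ Nat.log q S.length := Nat.cast_nonneg _
  have hq0 : (0 : ℝ) ≤ q := Nat.cast_nonneg _
  calc (M.card : ℝ) ≤ 12 * q * (Nat.log q S.length + 1) := hcard'
    _ ≤ 18 * q * (1 + Real.logb q S.length) := by
      gcongr ?_ * _ * ?_
      · norm_num
      · linarith
end

section
/- Let S be a string and let i, j be indices of characters in S$. Then there are at most 12·log₂|S| different maximal pairs (n_k, m_k, l_k) of S such that for all k there is a period length Δ with: (a) if |S[n_k..i−1]| ≥ |S[i..n_k+l_k−1]| then S[n_k..i−1] is a fractional power with exponent ≥ 3 and minimal period length Δ, and if |S[n_k..i−1]| < |S[i..n_k+l_k−1]| then S[i..n_k+l_k−1] is a fractional power with exponent ≥ 3 and minimal period length Δ; (b) the substring S[n_k..n_k+l_k−1] is not Δ-periodic; (c) i ∈ [n_k, n_k+l_k]; and (d) j ∈ [m_k, m_k+l_k]. -/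
variable {α : Type*}

/-- `(n, m, l)` is a maximal pair of the bi-infinite word `f` crossing `i` resp. `j`, whose part
left of `i` is the longer one and at least a cube with minimal period `Δ`, while `Δ` is not a
period of the whole repeat. -/
structure LeftCubePair (f : ℤ → α) (i j n m l Δ : ℤ) : Prop where
  n_le : n ≤ i
  le_n : i ≤ n + l
  m_le : m ≤ j
  le_m : j ≤ m + l
  eq_shift : ∀ x, n ≤ x → x < n + l → f x = f (x + (m - n))
  ne_left : f (n - 1) ≠ f (m - 1)
  ne_right : f (n + l) ≠ f (m + l)
  longer : n + l - i ≤ i - n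
  pos : 1 ≤ Δ
  cube : 3 * Δ ≤ i - n
  periodic : ∀ x, n ≤ x → x + Δ < i → f x = f (x + Δ)
  minimal : ∀ e, 1 ≤ e → (∀ x, n ≤ x → x + e < i → f x = f (x + e)) → Δ ≤ e
  break_exists : ∃ x, n ≤ x ∧ x + Δ < n + l ∧ f x ≠ f (x + Δ)

namespace LeftCubePair

variable {f : ℤ → α} {i j n m l Δ n' m' l' Δ' : ℤ}

/-- A period `p` of a suffix of length at least `p + q` of a `q`-periodic word is a period of the
whole word. -/
theorem period_of_suffix {a s p q : ℤ} (hq : 1 ≤ q) (hlen : s + p + q ≤ i)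
    (hper : ∀ x, a ≤ x → x + q < i → f x = f (x + q)) (hp : 1 ≤ p)
    (hsuf : ∀ x, s ≤ x → x + p < i → f x = f (x + p)) :
    ∀ x, a ≤ x → x + p < i → f x = f (x + p) := by
  suffices H : ∀ (k : ℕ) x, i - x ≤ k → a ≤ x → x + p < i → f x = f (x + p) from
    fun x => H (i - x).toNat x (by omega)
  intro k
  induction k with
  | zero => intro x _ _ _; omega
  | succ k ih =>
    intro x hk hx hxp
    by_cases hs : s ≤ x
    · exact hsuf x hs hxp
    · have h₁ := hper x hx (by omega)
      have h₂ := hper (x + p) (by omega) (by omega)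
      have h₃ := ih (x + q) (by push_cast at hk; omega) (by omega) (by omega)
      rw [h₁, h₂, h₃, add_right_comm]

theorem period_le {X : ℤ} (h : LeftCubePair f i j n m l Δ) (h' : LeftCubePair f i j n' m' l' Δ')
    (hX : X ≤ i - n) (hX' : i - n' < 2 * X) : Δ' ≤ Δ := by
  by_contra! hlt
  have := h.pos
  have := h.cube
  have := h'.cube
  refine hlt.not_ge (h'.minimal Δ h.pos ?_)
  by_cases hn : n ≤ n'
  · exact fun x hx => h.periodic x (hn.trans hx)
  · exact period_of_suffix h'.pos (by omega) h'.periodic h.pos h.periodic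

theorem exists_first_break (h : LeftCubePair f i j n m l Δ) :
    ∃ b, i ≤ b ∧ b < n + l ∧ f (b - Δ) ≠ f b ∧
      ∀ z, n + Δ ≤ z → z < b → f (z - Δ) = f z := by
  obtain ⟨x, hx, hxl, hne⟩ := h.break_exists
  obtain ⟨b, ⟨hb, hbl, hbne⟩, hmin⟩ := Int.exists_least_of_bdd
    (P := fun b => n + Δ ≤ b ∧ b < n + l ∧ f (b - Δ) ≠ f b)
    ⟨n + Δ, fun z hz => hz.1⟩ ⟨x + Δ, by omega, hxl, by simpa using hne⟩
  refine ⟨b, ?_, hbl, hbne, fun z hz hzb => ?_⟩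
  · by_contra! hlt
    exact hbne (by simpa using h.periodic (b - Δ) (by omega) (by omega))
  · by_contra hzne
    have := hmin z ⟨hz, by omega, hzne⟩
    omega

theorem eq_of_shift_eq (h : LeftCubePair f i j n m l Δ) (h' : LeftCubePair f i j n' m' l' Δ')
    (hd : m - n = m' - n') : n = n' ∧ m = m' ∧ l = l' := by
  have start_le : ∀ {n m l Δ n' m' l' Δ' : ℤ}, LeftCubePair f i j n m l Δ →
      LeftCubePair f i j n' m' l' Δ' → m - n = m' - n' → n' ≤ n := by
    intro n m l Δ n' m' l' Δ' h h' hd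
    by_contra! hlt
    have := h.le_n
    have := h'.n_le
    apply h'.ne_left
    rw [h.eq_shift (n' - 1) (by omega) (by omega)]
    congr 1
    omega
  have end_le : ∀ {n m l Δ n' m' l' Δ' : ℤ}, LeftCubePair f i j n m l Δ →
      LeftCubePair f i j n' m' l' Δ' → m - n = m' - n' → n' + l' ≤ n + l := by
    intro n m l Δ n' m' l' Δ' h h' hd
    by_contra! hlt
    have := h.le_n
    have := h'.n_le
    apply h.ne_right
    rw [h'.eq_shift (n + l) (by omega) (by omega)]
    congr 1
    omega
  have := start_le h h' hd
  have := start_le h' h hd.symm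
  have := end_le h h' hd
  have := end_le h' h hd.symm
  omega

/-- Two pairs with left parts of comparable length are equal, or their second occurrences start
far apart. -/
theorem eq_or_lt {X : ℤ} (h : LeftCubePair f i j n m l Δ) (h' : LeftCubePair f i j n' m' l' Δ')
    (hX₁ : X ≤ i - n) (hX₂ : i - n < 2 * X) (hX₁' : X ≤ i - n') (hX₂' : i - n' < 2 * X) :
    (n = n' ∧ m = m' ∧ l = l') ∨ 2 * X < 3 * (m' - m) ∨ 2 * X < 3 * (m - m') := by
  obtain rfl : Δ = Δ' := le_antisymm (h'.period_le h hX₁' hX₂) (h.period_le h' hX₁ hX₂')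
  obtain ⟨b, hib, hbl, hbne, hb⟩ := h.exists_first_break
  obtain ⟨b', hib', hbl', hbne', hb'⟩ := h'.exists_first_break
  have := h.pos
  have := h.cube
  have := h'.cube
  obtain rfl : b = b' := by
    rcases lt_trichotomy b b' with hlt | heq | hlt
    · exact absurd (hb' b (by omega) hlt) hbne
    · exact heq
    · exact absurd (hb b' (by omega) hlt) hbne'
  have far : ∀ {n m l n' m' l' : ℤ}, LeftCubePair f i j n m l Δ →
      LeftCubePair f i j n' m' l' Δ → b < n + l → b < n' + l' →
      (∀ z, n' + Δ ≤ z → z < b → f (z - Δ) = f z) → m - n < m' - n' →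
      b + (m - n) < m' + Δ := by
    intro n m l n' m' l' h h' hbl hbl' hb' hd
    by_contra! hle
    have := h.cube
    have h₁ := h.eq_shift b (by omega) hbl
    have h₂ := h.eq_shift (b - Δ) (by omega) (by omega)
    -- `z` corresponds to the copied break of the first pair
    obtain ⟨z, hz⟩ : ∃ z, z = b + (m - n) - (m' - n') := ⟨_, rfl⟩
    have h₃ := h'.eq_shift z (by omega) (by omega)
    have h₄ := h'.eq_shift (z - Δ) (by omega) (by omega)
    have h₅ := hb' z (by omega) (by omega)
    apply hbne
    rw [h₁, h₂]
    rw [h₃, h₄] at h₅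
    convert h₅ using 2 <;> omega
  rcases lt_trichotomy (m - n) (m' - n') with hd | hd | hd
  · have := far h h' hbl hbl' hb' hd
    omega
  · exact Or.inl (h.eq_of_shift_eq h' hd)
  · have := far h' h hbl' hbl hb hd
    omega

end LeftCubePair

theorem substr_length (dollar : α) (S : List α) (a b : ℕ) :
    (substr dollar S a b).length = b + 1 - a := by
  simp [substr]

theorem isPeriodOf_substr_s6 (dollar : α) (S : List α) (a b Δ : ℕ) :
    IsPeriodOf Δ (substr dollar S a b) ↔
      1 ≤ Δ ∧ ∀ x, a ≤ x → x + Δ < b + 1 → chr dollar S x = chr dollar S (x + Δ) := by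
  unfold IsPeriodOf
  refine and_congr_right fun _ => ⟨fun h x hx hxb => ?_, fun h k hk => ?_⟩
  · have := h (x - a) (by rw [substr_length]; omega)
    simp only [substr, List.get_eq_getElem, List.getElem_map, List.getElem_range] at this
    convert this using 2 <;> omega
  · rw [substr_length] at hk
    simp only [substr, List.get_eq_getElem, List.getElem_map, List.getElem_range]
    rw [h (a + k) (by omega) (by omega), add_assoc]

theorem isPeriodOf_minPeriod (T : List α) : IsPeriodOf (minPeriod T) T :=
  Nat.sInf_mem (s := {Δ | IsPeriodOf Δ T}) ⟨T.length + 1, by omega, fun _ _ => by omega⟩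

theorem minPeriod_le {Δ : ℕ} {T : List α} (h : IsPeriodOf Δ T) : minPeriod T ≤ Δ :=
  Nat.sInf_le h

section Transfer

variable {dollar : α} {S : List α} {i j n m l Δ : ℕ}

theorem leftCubePair_of_left (hi : 1 ≤ i) (hmax : IsMaximalPair dollar S n m l)
    (hlong : n + l - i ≤ i - n) (hmin : minPeriod (substr dollar S n (i - 1)) = Δ)
    (hcube : 3 * Δ ≤ i - n) (hnot : ¬ IsPeriodOf Δ (substr dollar S n (n + l - 1)))
    (hni : n ≤ i ∧ i ≤ n + l) (hmj : m ≤ j ∧ j ≤ m + l) :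
    LeftCubePair (fun x : ℤ => chr dollar S x.toNat) i j n m l Δ := by
  obtain ⟨hl, hn, hm, -, -, heq, hneL, hneR⟩ := hmax
  have hper := isPeriodOf_minPeriod (substr dollar S n (i - 1))
  rw [hmin, isPeriodOf_substr_s6] at hper
  rw [isPeriodOf_substr_s6] at hnot
  refine ⟨by omega, by omega, by omega, by omega, fun x hx hxl => ?_, ?_, ?_, by omega,
    by omega, by omega, fun x hx hxi => ?_, fun e he hpe => ?_, ?_⟩
  · convert heq (x.toNat - n) (by omega) using 2 <;> omega
  · convert hneL using 2 <;> omega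
  · convert hneR using 2 <;> omega
  · convert hper.2 x.toNat (by omega) (by omega) using 2; omega
  · have : IsPeriodOf e.toNat (substr dollar S n (i - 1)) := by
      rw [isPeriodOf_substr_s6]
      refine ⟨by omega, fun x hx hxi => ?_⟩
      convert hpe x (by omega) (by omega) using 2 <;> omega
    have := minPeriod_le this
    omega
  · by_contra! hall
    refine hnot ⟨hper.1, fun x hx hxl => ?_⟩
    exact hall x (by omega) (by omega)

/-- Reading the word backwards turns a long right part into a long left part. -/
theorem leftCubePair_of_right (hi : 1 ≤ i) (hmax : IsMaximalPair dollar S n m l)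
    (hlong : i - n ≤ n + l - i) (hmin : minPeriod (substr dollar S i (n + l - 1)) = Δ)
    (hcube : 3 * Δ ≤ n + l - i) (hnot : ¬ IsPeriodOf Δ (substr dollar S n (n + l - 1)))
    (hni : n ≤ i ∧ i ≤ n + l) (hmj : m ≤ j ∧ j ≤ m + l) :
    LeftCubePair (fun x : ℤ => chr dollar S (-x).toNat)
      (1 - i) (1 - j) (1 - n - l) (1 - m - l) l Δ := by
  obtain ⟨hl, hn, hm, -, -, heq, hneL, hneR⟩ := hmax
  have hper := isPeriodOf_minPeriod (substr dollar S i (n + l - 1))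
  rw [hmin, isPeriodOf_substr_s6] at hper
  rw [isPeriodOf_substr_s6] at hnot
  refine ⟨by omega, by omega, by omega, by omega, fun x hx hxl => ?_, ?_, ?_, by omega,
    by omega, by omega, fun x hx hxi => ?_, fun e he hpe => ?_, ?_⟩
  · convert heq ((-x).toNat - n) (by omega) using 2 <;> omega
  · convert hneR using 2 <;> omega
  · convert hneL using 2 <;> omega
  · convert (hper.2 (-(x + Δ)).toNat (by omega) (by omega)).symm using 2; omega
  · have : IsPeriodOf e.toNat (substr dollar S i (n + l - 1)) := by
      rw [isPeriodOf_substr_s6]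
      refine ⟨by omega, fun x hx hxi => ?_⟩
      convert (hpe (-(x + e)) (by omega) (by omega)).symm using 2 <;> omega
    have := minPeriod_le this
    omega
  · by_contra! hall
    refine hnot ⟨hper.1, fun x hx hxl => ?_⟩
    convert (hall (-(x + Δ)) (by omega) (by omega)).symm using 2 <;> omega

end Transfer

/-- Numbers falling into the same cell of length `2 * X / 3` are close to each other. -/
theorem three_mul_le_of_div_eq {X w w' : ℕ} (hX : 0 < X) (h : 3 * w / (2 * X) = 3 * w' / (2 * X)) :
    3 * w ≤ 3 * w' + 2 * X := by
  have h₁ := Nat.div_add_mod (3 * w) (2 * X)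
  have h₂ := Nat.div_add_mod (3 * w') (2 * X)
  have h₃ := Nat.mod_lt (3 * w) (show 0 < 2 * X by omega)
  rw [h] at h₁
  omega

/-- The dyadic scale of the longer part `u` together with the cell containing the offset `w`. -/
def scaleCell (u w : ℕ) : ℕ × ℕ := (Nat.log 2 u, 3 * w / (2 * 2 ^ Nat.log 2 u))

theorem scaleCell_mem {u w N : ℕ} (hu : 3 ≤ u) (huN : u ≤ N) (hw : w ≤ 2 * u) :
    scaleCell u w ∈ Finset.Icc 1 (Nat.log 2 N) ×ˢ Finset.range 6 := by
  have h₁ : u < 2 ^ (Nat.log 2 u + 1) := Nat.lt_pow_succ_log_self (by norm_num) u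
  rw [pow_succ] at h₁
  simp only [scaleCell, Finset.mem_product, Finset.mem_Icc, Finset.mem_range]
  refine ⟨⟨Nat.log_pos (by norm_num) (by omega), Nat.log_mono_right huN⟩, ?_⟩
  rw [Nat.div_lt_iff_lt_mul (by positivity)]
  omega

theorem scaleCell_eq {u w u' w' : ℕ} (hu : 3 ≤ u) (hu' : 3 ≤ u')
    (h : scaleCell u w = scaleCell u' w') :
    ∃ X, X ≤ u ∧ u < 2 * X ∧ X ≤ u' ∧ u' < 2 * X ∧
      3 * w ≤ 3 * w' + 2 * X ∧ 3 * w' ≤ 3 * w + 2 * X := by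
  simp only [scaleCell, Prod.mk.injEq] at h
  obtain ⟨hlog, hcell⟩ := h
  rw [← hlog] at hcell
  have h₁ : u < 2 ^ (Nat.log 2 u + 1) := Nat.lt_pow_succ_log_self (by norm_num) u
  have h₂ : u' < 2 ^ (Nat.log 2 u' + 1) := Nat.lt_pow_succ_log_self (by norm_num) u'
  have h₃ : 2 ^ Nat.log 2 u ≤ u := Nat.pow_log_le_self 2 (by omega)
  have h₄ : 2 ^ Nat.log 2 u' ≤ u' := Nat.pow_log_le_self 2 (by omega)
  rw [pow_succ] at h₁ h₂
  rw [← hlog] at h₂ h₄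
  exact ⟨2 ^ Nat.log 2 u, h₃, by omega, h₄, by omega,
    three_mul_le_of_div_eq (by positivity) hcell,
    three_mul_le_of_div_eq (by positivity) hcell.symm⟩

/-- Separates the pairs according to their longer side, its dyadic scale, and the cell containing
the offset of `j` in the second occurrence. -/
def pairKey (i j : ℕ) (p : ℕ × ℕ × ℕ) : Bool × ℕ × ℕ :=
  if p.1 + p.2.2 - i ≤ i - p.1 then (true, scaleCell (i - p.1) (j - p.2.1))
  else (false, scaleCell (p.1 + p.2.2 - i) (p.2.1 + p.2.2 - j))

/-- Theorem `nonhighly-nonextended`. For indices `i`, `j` of characters in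
`S$` there are at most `12·log₂|S|` maximal pairs crossing `i` resp. `j` such that the longer
part of the first occurrence split at `i` is at least a cube with minimal period length `Δ`,
while the whole maximal repeat is not `Δ`-periodic. -/
theorem maximal_pairs_nonextended_cubes (dollar : α) (S : List α)
    (hdollar : dollar ∉ S)
    (i j : ℕ) (hi : 1 ≤ i ∧ i ≤ S.length + 1) (hj : 1 ≤ j ∧ j ≤ S.length + 1)
    (M : Finset (ℕ × ℕ × ℕ))
    (hM : ∀ p ∈ M, IsMaximalPair dollar S p.1 p.2.1 p.2.2 ∧
      ∃ Δ : ℕ, 1 ≤ Δ ∧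
        ((substr dollar S p.1 (i - 1)).length ≥ (substr dollar S i (p.1 + p.2.2 - 1)).length →
          minPeriod (substr dollar S p.1 (i - 1)) = Δ ∧
            3 * Δ ≤ (substr dollar S p.1 (i - 1)).length) ∧
        ((substr dollar S p.1 (i - 1)).length < (substr dollar S i (p.1 + p.2.2 - 1)).length →
          minPeriod (substr dollar S i (p.1 + p.2.2 - 1)) = Δ ∧
            3 * Δ ≤ (substr dollar S i (p.1 + p.2.2 - 1)).length) ∧
        ¬ IsPeriodOf Δ (substr dollar S p.1 (p.1 + p.2.2 - 1)) ∧
        (p.1 ≤ i ∧ i ≤ p.1 + p.2.2) ∧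
        (p.2.1 ≤ j ∧ j ≤ p.2.1 + p.2.2)) :
    (M.card : ℝ) ≤ 12 * Real.logb 2 (S.length : ℝ) := by
  have key : ∀ p ∈ M,
      (p.1 + p.2.2 - i ≤ i - p.1 ∧ 3 ≤ i - p.1 ∧ i - p.1 ≤ S.length ∧
        ∃ Δ : ℤ, LeftCubePair (fun x : ℤ => chr dollar S x.toNat) i j p.1 p.2.1 p.2.2 Δ) ∨
      (i - p.1 < p.1 + p.2.2 - i ∧ 3 ≤ p.1 + p.2.2 - i ∧ p.1 + p.2.2 - i ≤ S.length ∧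
        ∃ Δ : ℤ, LeftCubePair (fun x : ℤ => chr dollar S (-x).toNat) (1 - i) (1 - j)
          (1 - p.1 - p.2.2) (1 - p.2.1 - p.2.2) p.2.2 Δ) := by
    intro p hp
    obtain ⟨hmax, Δ, hΔ, hL, hR, hnot, hni, hmj⟩ := hM p hp
    obtain ⟨hl, hn, hm, hnS, -⟩ := id hmax
    have hlenL : i - 1 + 1 - p.1 = i - p.1 := by omega
    have hlenR : p.1 + p.2.2 - 1 + 1 - i = p.1 + p.2.2 - i := by omega
    simp only [substr_length, hlenL, hlenR] at hL hR
    rcases le_or_gt (p.1 + p.2.2 - i) (i - p.1) with h | h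
    · obtain ⟨hmin, hcube⟩ := hL h
      exact Or.inl ⟨h, by omega, by omega, Δ,
        leftCubePair_of_left hi.1 hmax h hmin hcube hnot hni hmj⟩
    · obtain ⟨hmin, hcube⟩ := hR h
      exact Or.inr ⟨h, by omega, by omega, Δ,
        leftCubePair_of_right hi.1 hmax h.le hmin hcube hnot hni hmj⟩
  have hmaps : Set.MapsTo (pairKey i j) M
      ((Finset.univ : Finset Bool) ×ˢ Finset.Icc 1 (Nat.log 2 S.length) ×ˢ Finset.range 6 :
        Finset (Bool × ℕ × ℕ)) := by
    intro p hp
    rw [Finset.mem_coe, Finset.mem_product]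
    refine ⟨Finset.mem_univ _, ?_⟩
    obtain ⟨-, -, -, -, -, -, hni, hmj⟩ := hM p hp
    rcases key p hp with ⟨h, h3, hS, -⟩ | ⟨h, h3, hS, -⟩
    · rw [pairKey, if_pos h]
      exact scaleCell_mem h3 hS (by omega)
    · rw [pairKey, if_neg (by omega)]
      exact scaleCell_mem h3 hS (by omega)
  have hinj : Set.InjOn (pairKey i j) M := by
    intro p hp q hq hpq
    obtain ⟨-, -, -, -, -, -, hni, hmj⟩ := hM p hp
    obtain ⟨-, -, -, -, -, -, hni', hmj'⟩ := hM q hq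
    suffices p.1 = q.1 ∧ p.2.1 = q.2.1 ∧ p.2.2 = q.2.2 from
      Prod.ext this.1 (Prod.ext this.2.1 this.2.2)
    rcases key p hp with ⟨h, h3, -, Δ, hc⟩ | ⟨h, h3, -, Δ, hc⟩ <;>
      rcases key q hq with ⟨h', h3', -, Δ', hc'⟩ | ⟨h', h3', -, Δ', hc'⟩
    · rw [pairKey, pairKey, if_pos h, if_pos h', Prod.mk.injEq] at hpq
      obtain ⟨X, hX⟩ := scaleCell_eq h3 h3' hpq.2
      have := hc.eq_or_lt hc' (X := X) (by omega) (by omega) (by omega) (by omega)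
      omega
    · rw [pairKey, pairKey, if_pos h, if_neg (by omega), Prod.mk.injEq] at hpq
      exact absurd hpq.1 (by decide)
    · rw [pairKey, pairKey, if_neg (by omega), if_pos h', Prod.mk.injEq] at hpq
      exact absurd hpq.1 (by decide)
    · rw [pairKey, pairKey, if_neg (by omega), if_neg (by omega), Prod.mk.injEq] at hpq
      obtain ⟨X, hX⟩ := scaleCell_eq h3 h3' hpq.2
      have := hc.eq_or_lt hc' (X := X) (by omega) (by omega) (by omega) (by omega)
      omega
  have hcard := Finset.card_le_card_of_injOn _ hmaps hinj
  simp only [Finset.card_product, Finset.card_univ, Fintype.card_bool, Nat.card_Icc,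
    Finset.card_range, Nat.add_sub_cancel] at hcard
  have hlog : (Nat.log 2 S.length : ℝ) ≤ Real.logb 2 (S.length : ℝ) := by
    exact_mod_cast Real.natLog_le_logb S.length 2
  have hcard' : (M.card : ℝ) ≤ 12 * (Nat.log 2 S.length : ℝ) := by
    exact_mod_cast (by omega : M.card ≤ 12 * Nat.log 2 S.length)
  linarith
end
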